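/- arXiv:2405.17267 — 9 statements merged into one kernel-verified Lean document; each statement's English description precedes it below -/
import Mathlib

section
/- Let X be a measurable space and Y a finite nonempty type. Let μ_k and μ_T be probability measures on X × Y, let H be a nonempty set of measurable functions from X to Y, let h : X → Y be measurable, and let h' ∈ H. Then R_{μ_T}(h) ≤ R_{μ_k}(h) + R_{μ_k}(h') + R_{μ_T}(h') + d_h(μ_k, μ_T), where R_μ(f) = μ({(x,y) : f x ≠ y}) and d_h(μ_k, μ_T) = sup_{g ∈ H} |μ_T^X({x : h x ≠ g x}) − μ_k^X({x : h x ≠ g x})| with μ^X the marginal of μ on X. -/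
open MeasureTheory

/-- When the second factor is finite, the first marginal of a measure on a product agrees with
the measure of the cylinder on every set, measurable or not. -/
theorem MeasureTheory.Measure.map_fst_apply_of_finite {X Y : Type*} [MeasurableSpace X]
    [MeasurableSpace Y] [Finite Y] (μ : Measure (X × Y)) (s : Set X) :
    μ.map Prod.fst s = μ (Prod.fst ⁻¹' s) := by
  refine le_antisymm ?_ (Measure.le_map_apply measurable_fst.aemeasurable s)
  set C := toMeasurable μ (Prod.fst ⁻¹' s)
  have hB : MeasurableSet (⋂ y : Y, (fun x : X => (x, y)) ⁻¹' C) :=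
    MeasurableSet.iInter fun y => measurable_prodMk_right (measurableSet_toMeasurable _ _)
  have hsB : s ⊆ ⋂ y : Y, (fun x : X => (x, y)) ⁻¹' C := fun x hx =>
    Set.mem_iInter.2 fun y => subset_toMeasurable μ (Prod.fst ⁻¹' s) (show (x, y).1 ∈ s from hx)
  calc μ.map Prod.fst s ≤ μ.map Prod.fst (⋂ y : Y, (fun x : X => (x, y)) ⁻¹' C) :=
        measure_mono hsB
    _ = μ (Prod.fst ⁻¹' ⋂ y : Y, (fun x : X => (x, y)) ⁻¹' C) :=
        Measure.map_apply measurable_fst hB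
    _ ≤ μ C := measure_mono fun p hp => Set.mem_iInter.1 hp p.2
    _ = μ (Prod.fst ⁻¹' s) := measure_toMeasurable _

/-- Domain-adaptation bound: the test risk of `h` is bounded by its local risk,
the adaptation error of any reference model `h' ∈ H`, plus the discrepancy. -/
theorem risk_domain_adaptation_bound
    {X Y : Type*} [MeasurableSpace X] [MeasurableSpace Y] [Fintype Y] [Nonempty Y]
    (μk μT : Measure (X × Y)) [IsProbabilityMeasure μk] [IsProbabilityMeasure μT]
    (H : Set (X → Y)) (hH : H.Nonempty) (hHmeas : ∀ g ∈ H, Measurable g)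
    (h : X → Y) (hmeas : Measurable h) (h' : X → Y) (hh' : h' ∈ H) :
    (μT {s : X × Y | h s.1 ≠ s.2}).toReal ≤
      (μk {s : X × Y | h s.1 ≠ s.2}).toReal
      + (μk {s : X × Y | h' s.1 ≠ s.2}).toReal
      + (μT {s : X × Y | h' s.1 ≠ s.2}).toReal
      + sSup {r : ℝ | ∃ g ∈ H,
          r = |((μT.map Prod.fst) {x : X | h x ≠ g x}).toReal
              - ((μk.map Prod.fst) {x : X | h x ≠ g x}).toReal|} := by
  have hT : (μT {s : X × Y | h s.1 ≠ s.2}).toReal ≤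
      (μT {s : X × Y | h' s.1 ≠ s.2}).toReal
      + ((μT.map Prod.fst) {x : X | h x ≠ h' x}).toReal := by
    rw [Measure.map_fst_apply_of_finite]
    refine (measureReal_mono (μ := μT) ?_).trans (measureReal_union_le _ _)
    intro s hs
    by_contra hn
    simp_all
  have hk : ((μk.map Prod.fst) {x : X | h x ≠ h' x}).toReal ≤
      (μk {s : X × Y | h s.1 ≠ s.2}).toReal + (μk {s : X × Y | h' s.1 ≠ s.2}).toReal := by
    rw [Measure.map_fst_apply_of_finite]
    refine (measureReal_mono (μ := μk) ?_).trans (measureReal_union_le _ _)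
    intro s hs
    by_contra hn
    simp_all
  have : IsProbabilityMeasure (μT.map Prod.fst) :=
    Measure.isProbabilityMeasure_map measurable_fst.aemeasurable
  have : IsProbabilityMeasure (μk.map Prod.fst) :=
    Measure.isProbabilityMeasure_map measurable_fst.aemeasurable
  have hbdd : BddAbove {r : ℝ | ∃ g ∈ H,
      r = |((μT.map Prod.fst) {x : X | h x ≠ g x}).toReal
          - ((μk.map Prod.fst) {x : X | h x ≠ g x}).toReal|} := by
    refine ⟨1, ?_⟩
    rintro r ⟨g, -, rfl⟩
    exact abs_sub_le_of_nonneg_of_le ENNReal.toReal_nonneg measureReal_le_one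
      ENNReal.toReal_nonneg measureReal_le_one
  have hd := (le_abs_self _).trans (le_csSup hbdd ⟨h', hh', rfl⟩)
  linarith
end

section
/- Let X be a measurable space and Y a finite nonempty type. Let μ_k and μ_T be probability measures on X × Y, let H be a nonempty set of measurable functions from X to Y, let h : X → Y be measurable, and let h' ∈ H. Then R_{μ_T}(h) ≤ μ_k^X({x : h x ≠ h' x}) + R_{μ_T}(h') + d_h(μ_k, μ_T), where R_μ(f) = μ({(x,y) : f x ≠ y}) and d_h(μ_k, μ_T) = sup_{g ∈ H} |μ_T^X({x : h x ≠ g x}) − μ_k^X({x : h x ≠ g x})| with μ^X the marginal of μ on X. -/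
open MeasureTheory

/-- Intermediate step (Eq. risk1): the test risk of `h` is controlled by the
probability under the local input distribution that `h` and `h'` disagree,
the test risk of `h'`, and the discrepancy term. -/
theorem risk_bound_via_disagreement
    {X Y : Type*} [MeasurableSpace X] [MeasurableSpace Y] [Fintype Y] [Nonempty Y]
    (μk μT : Measure (X × Y)) [IsProbabilityMeasure μk] [IsProbabilityMeasure μT]
    (H : Set (X → Y)) (hH : H.Nonempty) (hHmeas : ∀ g ∈ H, Measurable g)
    (h : X → Y) (hmeas : Measurable h) (h' : X → Y) (hh' : h' ∈ H) :
    (μT {s : X × Y | h s.1 ≠ s.2}).toReal ≤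
      ((μk.map Prod.fst) {x : X | h x ≠ h' x}).toReal
      + (μT {s : X × Y | h' s.1 ≠ s.2}).toReal
      + sSup {r : ℝ | ∃ g ∈ H,
          r = |((μT.map Prod.fst) {x : X | h x ≠ g x}).toReal
              - ((μk.map Prod.fst) {x : X | h x ≠ g x}).toReal|} := by
  have : IsProbabilityMeasure (μT.map Prod.fst) :=
    Measure.isProbabilityMeasure_map measurable_fst.aemeasurable
  have : IsProbabilityMeasure (μk.map Prod.fst) :=
    Measure.isProbabilityMeasure_map measurable_fst.aemeasurable
  simp only [← measureReal_def]
  have risk_le : μT.real {s : X × Y | h s.1 ≠ s.2} ≤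
      (μT.map Prod.fst).real {x : X | h x ≠ h' x} + μT.real {s : X × Y | h' s.1 ≠ s.2} := by
    have subset_union : {s : X × Y | h s.1 ≠ s.2} ⊆
        Prod.fst ⁻¹' {x : X | h x ≠ h' x} ∪ {s : X × Y | h' s.1 ≠ s.2} := by
      intro s hs
      by_cases heq : h s.1 = h' s.1
      · exact Or.inr fun hs' => hs (heq.trans hs')
      · exact Or.inl heq
    -- Disagreement sets need not be measurable, so only the outer-measure inequality is available.
    have preimage_le : μT.real (Prod.fst ⁻¹' {x : X | h x ≠ h' x}) ≤
        (μT.map Prod.fst).real {x : X | h x ≠ h' x} :=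
      ENNReal.toReal_mono (measure_ne_top _ _)
        (Measure.le_map_apply measurable_fst.aemeasurable _)
    linarith [measureReal_mono (μ := μT) subset_union,
      measureReal_union_le (μ := μT) (Prod.fst ⁻¹' {x : X | h x ≠ h' x})
        {s : X × Y | h' s.1 ≠ s.2}]
  have bddAbove : BddAbove {r : ℝ | ∃ g ∈ H,
      r = |(μT.map Prod.fst).real {x : X | h x ≠ g x}
        - (μk.map Prod.fst).real {x : X | h x ≠ g x}|} := by
    refine ⟨1, ?_⟩
    rintro _ ⟨g, -, rfl⟩
    exact abs_sub_le_of_nonneg_of_le measureReal_nonneg measureReal_le_one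
      measureReal_nonneg measureReal_le_one
  linarith [le_csSup bddAbove ⟨h', hh', rfl⟩,
    le_abs_self ((μT.map Prod.fst).real {x : X | h x ≠ h' x}
      - (μk.map Prod.fst).real {x : X | h x ≠ h' x})]
end

section
/- Let Θ be a measurable space with prior probability measure π, let (Z, ν) be a probability space, let C > 0, and let ℓ : Θ × Z → ℝ be jointly measurable with 0 ≤ ℓ(θ,z) ≤ C for all θ, z. For a sample S = (z_1,…,z_m) ∈ Z^m let R̂_S(θ) = (1/m) Σ_{i=1}^m ℓ(θ, z_i) and R(θ) = ∫ ℓ(θ, z) dν(z). Then for every t > 0 and every ε ∈ (0,1), with probability at least 1 − ε over S drawn from the m-fold product measure ν^{⊗m}, the following holds: for every probability measure ρ on Θ with finite Kullback–Leibler divergence KL(ρ‖π), ∫ R dρ ≤ ∫ R̂_S dρ + (KL(ρ‖π) − log ε) / (t·m) + t·C² / 8. -/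
open MeasureTheory

/-- **Donsker–Varadhan inequality**: the easy direction of the variational formula. -/
lemma integral_le_integral_llr_add_log_integral_exp {α : Type*} [MeasurableSpace α]
    {μ ν : Measure α} [IsProbabilityMeasure μ] [IsProbabilityMeasure ν] {f : α → ℝ}
    (hμν : μ ≪ ν) (hllr : Integrable (llr μ ν) μ) (hf : Integrable f μ)
    (hexp : Integrable (fun x => Real.exp (f x)) ν) :
    ∫ x, f x ∂μ ≤ ∫ x, llr μ ν x ∂μ + Real.log (∫ x, Real.exp (f x) ∂ν) := by
  have := isProbabilityMeasure_tilted hexp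
  have h := InformationTheory.integral_llr_add_sub_measure_univ_nonneg
    (hμν.trans (absolutelyContinuous_tilted hexp))
    (integrable_llr_tilted_right hμν hf hllr hexp)
  rw [integral_llr_tilted_right hμν hf hexp hllr, probReal_univ, probReal_univ] at h
  linarith

/-- Moment generating function bound for the deviation of an i.i.d. sum of bounded variables. -/
lemma integral_exp_sum_sub_le {Z ι : Type*} [MeasurableSpace Z] [Fintype ι]
    {ν : Measure Z} [IsProbabilityMeasure ν] {g : Z → ℝ} {C : ℝ} (hg : Measurable g)
    (hgC : ∀ z, g z ∈ Set.Icc 0 C) (t : ℝ) :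
    ∫ S, Real.exp (t * ∑ i, (∫ z, g z ∂ν - g (S i))) ∂(Measure.pi fun _ : ι => ν) ≤
      Real.exp (Fintype.card ι * (t ^ 2 * C ^ 2 / 8)) := by
  have hoeffding := (ProbabilityTheory.hasSubgaussianMGF_of_mem_Icc hg.aemeasurable
    (Filter.Eventually.of_forall hgC) : ProbabilityTheory.HasSubgaussianMGF _ _ ν).mgf_le (-t)
  have single : ∫ z, Real.exp (t * (∫ z, g z ∂ν - g z)) ∂ν ≤ Real.exp (t ^ 2 * C ^ 2 / 8) := by
    convert hoeffding using 2
    · simp only [ProbabilityTheory.mgf]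
      congr with z
      ring_nf
    · simp only [NNReal.coe_pow, NNReal.coe_div, coe_nnnorm, NNReal.coe_ofNat, div_pow,
        Real.norm_eq_abs, sq_abs]
      ring
  simp_rw [Finset.mul_sum, Real.exp_sum]
  rw [integral_fintype_prod_eq_pow (fun z => Real.exp (t * (∫ z, g z ∂ν - g z))), Real.exp_nat_mul]
  exact pow_le_pow_left₀ (integral_nonneg fun _ => (Real.exp_pos _).le) single _

/-- **Markov's inequality**, as a lower bound on the probability of staying below `B / ε`. -/
lemma one_sub_le_measureReal_lt_div {Ω : Type*} [MeasurableSpace Ω] {μ : Measure Ω}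
    [IsProbabilityMeasure μ] {G : Ω → ℝ} (hG : Measurable G) (hG0 : 0 ≤ G)
    (hint : Integrable G μ) {B ε : ℝ} (hB : 0 < B) (hε : 0 < ε) (hGB : ∫ ω, G ω ∂μ ≤ B) :
    1 - ε ≤ μ.real {ω | G ω < B / ε} := by
  have hmarkov := mul_meas_ge_le_integral_of_nonneg (Filter.Eventually.of_forall hG0) hint (B / ε)
  have hcompl : {ω | G ω < B / ε} = {ω | B / ε ≤ G ω}ᶜ := by ext; simp
  rw [hcompl, probReal_compl_eq_one_sub (measurableSet_le measurable_const hG)]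
  have hle : B / ε * μ.real {ω | B / ε ≤ G ω} ≤ B / ε * ε := by
    rw [div_mul_cancel₀ _ hε.ne']
    exact hmarkov.trans hGB
  linarith [le_of_mul_le_mul_left hle (div_pos hB hε)]

/-- PAC-Bayes theorem (linear form): with probability at least `1 − ε` over an
i.i.d. sample of size `m`, for every posterior `ρ` with finite KL divergence to
the prior `π`, the true risk is bounded by the empirical risk plus
`(KL(ρ‖π) − log ε)/(t m) + t C²/8`. -/
theorem pac_bayes_linear
    {Θ Z : Type*} [MeasurableSpace Θ] [MeasurableSpace Z]
    (π : Measure Θ) [IsProbabilityMeasure π]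
    (ν : Measure Z) [IsProbabilityMeasure ν]
    (C : ℝ) (hC : 0 < C)
    (ℓ : Θ × Z → ℝ) (hmeas : Measurable ℓ)
    (hbound : ∀ θ z, ℓ (θ, z) ∈ Set.Icc 0 C)
    (m : ℕ) (hm : 0 < m) (t : ℝ) (ht : 0 < t) (ε : ℝ) (hε : ε ∈ Set.Ioo (0 : ℝ) 1) :
    (1 - ε : ℝ) ≤
      ((Measure.pi fun _ : Fin m => ν) {S : Fin m → Z |
        ∀ ρ : Measure Θ, IsProbabilityMeasure ρ → ρ ≪ π → Integrable (llr ρ π) ρ →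
          ∫ θ, (∫ z, ℓ (θ, z) ∂ν) ∂ρ ≤
            (∫ θ, ((1 / m : ℝ) * ∑ i, ℓ (θ, S i)) ∂ρ)
            + ((∫ θ, llr ρ π θ ∂ρ) - Real.log ε) / (t * m)
            + t * C ^ 2 / 8}).toReal := by
  obtain ⟨hε0, -⟩ := hε
  set P := Measure.pi fun _ : Fin m => ν
  set R : Θ → ℝ := fun θ => ∫ z, ℓ (θ, z) ∂ν
  have hR_meas : Measurable R := hmeas.stronglyMeasurable.integral_prod_right'.measurable
  have hℓ_meas (θ : Θ) : Measurable fun z => ℓ (θ, z) := hmeas.comp measurable_prodMk_left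
  have hℓ_int (θ : Θ) : Integrable (fun z => ℓ (θ, z)) ν :=
    Integrable.of_mem_Icc 0 C (hℓ_meas θ).aemeasurable (Filter.Eventually.of_forall (hbound θ))
  have hR_mem (θ : Θ) : R θ ∈ Set.Icc 0 C := by
    refine ⟨integral_nonneg fun z => (hbound θ z).1, ?_⟩
    simpa using integral_mono (hℓ_int θ) (integrable_const C) fun z => (hbound θ z).2
  let F : (Fin m → Z) × Θ → ℝ := fun p => t * ∑ i, (R p.2 - ℓ (p.2, p.1 i))
  have hF_meas : Measurable F := by fun_prop
  have hF_le (p : (Fin m → Z) × Θ) : |F p| ≤ t * (m * C) := by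
    rw [abs_mul, abs_of_pos ht]
    gcongr
    refine (Finset.abs_sum_le_sum_abs _ _).trans ?_
    refine (Finset.sum_le_card_nsmul _ _ C fun i _ => ?_).trans (by simp)
    have h₁ := hR_mem p.2
    have h₂ := hbound p.2 (p.1 i)
    exact abs_le.2 ⟨by linarith [h₁.1, h₂.2], by linarith [h₁.2, h₂.1]⟩
  have hexp_le (p : (Fin m → Z) × Θ) : ‖Real.exp (F p)‖ ≤ Real.exp (t * (m * C)) := by
    rw [Real.norm_eq_abs, Real.abs_exp]
    exact Real.exp_le_exp.2 (le_of_abs_le (hF_le p))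
  have hexp_int : Integrable (fun p => Real.exp (F p)) (P.prod π) :=
    .of_bound hF_meas.exp.aestronglyMeasurable _ (Filter.Eventually.of_forall hexp_le)
  let G : (Fin m → Z) → ℝ := fun S => ∫ θ, Real.exp (F (S, θ)) ∂π
  have hG_meas : Measurable G :=
    hF_meas.exp.stronglyMeasurable.integral_prod_right'.measurable
  have hG_le : ∫ S, G S ∂P ≤ Real.exp (m * (t ^ 2 * C ^ 2 / 8)) := by
    calc ∫ S, G S ∂P = ∫ θ, ∫ S, Real.exp (F (S, θ)) ∂P ∂π := integral_integral_swap hexp_int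
      _ ≤ ∫ _, Real.exp (m * (t ^ 2 * C ^ 2 / 8)) ∂π := by
        refine integral_mono hexp_int.integral_prod_right (integrable_const _) fun θ => ?_
        simpa only [Fintype.card_fin] using
          integral_exp_sum_sub_le (ι := Fin m) (ν := ν) (hℓ_meas θ) (hbound θ) t
      _ = Real.exp (m * (t ^ 2 * C ^ 2 / 8)) := by simp
  refine (one_sub_le_measureReal_lt_div hG_meas
    (fun S => integral_nonneg fun θ => (Real.exp_pos _).le) hexp_int.integral_prod_left
    (Real.exp_pos _) hε0 hG_le).trans (measureReal_mono ?_)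
  intro S hS ρ hρ hac hllr
  have hFS_meas : Measurable fun θ => F (S, θ) := hF_meas.comp measurable_prodMk_left
  have hFS_int : Integrable (fun θ => F (S, θ)) ρ :=
    .of_bound hFS_meas.aestronglyMeasurable _ (Filter.Eventually.of_forall fun θ => hF_le (S, θ))
  have hFS_exp : Integrable (fun θ => Real.exp (F (S, θ))) π :=
    .of_bound hFS_meas.exp.aestronglyMeasurable _
      (Filter.Eventually.of_forall fun θ => hexp_le (S, θ))
  have hdv := integral_le_integral_llr_add_log_integral_exp hac hllr hFS_int hFS_exp
  have hlog : Real.log (∫ θ, Real.exp (F (S, θ)) ∂π) ≤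
      m * (t ^ 2 * C ^ 2 / 8) - Real.log ε := by
    rw [← Real.log_exp (m * (t ^ 2 * C ^ 2 / 8)), ← Real.log_div (Real.exp_pos _).ne' hε0.ne']
    exact Real.log_le_log (integral_exp_pos hFS_exp) (le_of_lt hS)
  have hR_int : Integrable R ρ :=
    Integrable.of_mem_Icc 0 C hR_meas.aemeasurable (Filter.Eventually.of_forall hR_mem)
  have hemp_int : Integrable (fun θ => (1 / m : ℝ) * ∑ i, ℓ (θ, S i)) ρ :=
    (integrable_finsetSum _ fun i _ => Integrable.of_mem_Icc 0 C
      (hmeas.comp measurable_prodMk_right).aemeasurable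
      (Filter.Eventually.of_forall fun θ => hbound θ (S i))).const_mul _
  have hm0 : (0 : ℝ) < m := Nat.cast_pos.2 hm
  have hF_eq : ∫ θ, F (S, θ) ∂ρ =
      t * m * (∫ θ, R θ ∂ρ - ∫ θ, (1 / m : ℝ) * ∑ i, ℓ (θ, S i) ∂ρ) := by
    rw [← integral_sub hR_int hemp_int, ← integral_const_mul]
    congr with θ
    simp only [F, Finset.sum_sub_distrib, Finset.sum_const, Finset.card_univ, Fintype.card_fin,
      nsmul_eq_mul]
    field_simp
  have hmain : ∫ θ, R θ ∂ρ - ∫ θ, (1 / m : ℝ) * ∑ i, ℓ (θ, S i) ∂ρ ≤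
      (∫ θ, llr ρ π θ ∂ρ - Real.log ε + m * (t ^ 2 * C ^ 2 / 8)) / (t * m) := by
    rw [le_div_iff₀' (mul_pos ht hm0), ← hF_eq]
    linarith
  have hsplit : (∫ θ, llr ρ π θ ∂ρ - Real.log ε + m * (t ^ 2 * C ^ 2 / 8)) / (t * m) =
      (∫ θ, llr ρ π θ ∂ρ - Real.log ε) / (t * m) + t * C ^ 2 / 8 := by
    field_simp
  linarith
end

section
/- Let Θ be a countable type, let p : Θ → ℝ be a probability mass function with p(θ) > 0 for all θ, let (Z, ν) be a probability space, let C > 0, and let ℓ : Θ × Z → ℝ be measurable in z for each θ with 0 ≤ ℓ(θ,z) ≤ C for all θ, z. For a sample S = (z_1,…,z_m) ∈ Z^m let R̂_S(θ) = (1/m) Σ_{i=1}^m ℓ(θ, z_i) and R(θ) = ∫ ℓ(θ, z) dν(z). Then for every t > 0 and every ε ∈ (0,1), with probability at least 1 − ε over S drawn from the m-fold product measure ν^{⊗m}: for every θ ∈ Θ, R(θ) ≤ R̂_S(θ) + (−log p(θ) − log ε) / (t·m) + t·C² / 8. -/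
open MeasureTheory

/-- Chernoff form of Hoeffding's inequality for the lower deviation of an i.i.d. sum of
`[0, C]`-bounded variables, with free exponential parameter `t`. -/
theorem measureReal_pi_integral_sub_sum_ge_le
    {Z : Type*} [MeasurableSpace Z] (ν : Measure Z) [IsProbabilityMeasure ν]
    {C : ℝ} {f : Z → ℝ} (hf : Measurable f) (hb : ∀ z, f z ∈ Set.Icc 0 C)
    (m : ℕ) {t : ℝ} (ht : 0 ≤ t) (a : ℝ) :
    (Measure.pi fun _ : Fin m => ν).real {S | a ≤ ∑ i, (∫ z, f z ∂ν - f (S i))} ≤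
      Real.exp (-t * a + m * (t ^ 2 * C ^ 2 / 8)) := by
  have hsub := (ProbabilityTheory.hasSubgaussianMGF_of_mem_Icc (μ := ν) hf.aemeasurable
    (ae_of_all _ hb)).neg
  have hsum := ProbabilityTheory.HasSubgaussianMGF.sum_of_iIndepFun
    (μ := Measure.pi fun _ : Fin m => ν) (s := Finset.univ)
    (X := fun i S => ∫ z, f z ∂ν - f (S i)) (c := fun _ => (‖C - 0‖₊ / 2) ^ 2)
    (ProbabilityTheory.iIndepFun_pi (X := fun _ z => ∫ z, f z ∂ν - f z)
      fun _ => (hf.const_sub _).aemeasurable)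
    (fun i _ => by
      refine ProbabilityTheory.HasSubgaussianMGF.of_map
        (Y := fun S : Fin m → Z => S i) (X := fun z => ∫ z, f z ∂ν - f z)
        (measurable_pi_apply i).aemeasurable ?_
      rw [(measurePreserving_eval (fun _ : Fin m => ν) i).map_eq]
      convert hsub using 1
      ext z
      simp)
  refine (ProbabilityTheory.measure_ge_le_exp_mul_mgf a ht
    (hsum.integrable_exp_mul t)).trans ?_
  rw [Real.exp_add]
  refine mul_le_mul_of_nonneg_left ((hsum.mgf_le t).trans_eq ?_) (Real.exp_nonneg _)
  congr 1
  simp [div_pow]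
  ring

/-- Union bound: if the countably many bad events have probabilities at most `ε * p θ`, with
`p` a probability mass function, then all good events hold with probability at least `1 - ε`. -/
theorem one_sub_le_measureReal_forall {Ω Θ : Type*} [Countable Θ] [MeasurableSpace Ω]
    (μ : Measure Ω) [IsProbabilityMeasure μ] {p : Θ → ℝ} (hp : ∀ θ, 0 ≤ p θ)
    (hp_sum : HasSum p 1) {ε : ℝ} (hε : 0 ≤ ε) {P : Θ → Ω → Prop}
    (hP : ∀ θ, μ.real {ω | ¬ P θ ω} ≤ ε * p θ) :
    1 - ε ≤ μ.real {ω | ∀ θ, P θ ω} := by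
  have hbad : μ.real {ω | ∀ θ, P θ ω}ᶜ ≤ ε := by
    refine ENNReal.toReal_le_of_le_ofReal hε ?_
    calc μ {ω | ∀ θ, P θ ω}ᶜ = μ (⋃ θ, {ω | ¬ P θ ω}) := by
          congr 1
          ext ω
          simp
      _ ≤ ∑' θ, μ {ω | ¬ P θ ω} := measure_iUnion_le _
      _ ≤ ∑' θ, ENNReal.ofReal (ε * p θ) := by
          refine ENNReal.tsum_le_tsum fun θ => ?_
          rw [← ofReal_measureReal]
          exact ENNReal.ofReal_le_ofReal (hP θ)
      _ = ENNReal.ofReal ε := by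
          have h := hp_sum.mul_left ε
          rw [← ENNReal.ofReal_tsum_of_nonneg (fun θ => mul_nonneg hε (hp θ)) h.summable,
            h.tsum_eq, mul_one]
  have huniv := measureReal_union_le (μ := μ) {ω | ∀ θ, P θ ω} {ω | ∀ θ, P θ ω}ᶜ
  rw [Set.union_compl_self, probReal_univ] at huniv
  linarith

/-- Pointwise PAC-Bayes bound (linear form) with a countable prior: with
probability at least `1 − ε` over an i.i.d. sample of size `m`, every
parameter `θ` satisfies
`R(θ) ≤ R̂_S(θ) + (−log p(θ) − log ε)/(t m) + t C²/8`. -/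
theorem pac_bayes_pointwise_linear
    {Θ Z : Type*} [Countable Θ] [MeasurableSpace Z]
    (p : Θ → ℝ) (hp_pos : ∀ θ, 0 < p θ) (hp_sum : ∑' θ, p θ = 1)
    (ν : Measure Z) [IsProbabilityMeasure ν]
    (C : ℝ) (hC : 0 < C)
    (ℓ : Θ → Z → ℝ) (hmeas : ∀ θ, Measurable (ℓ θ))
    (hbound : ∀ θ z, ℓ θ z ∈ Set.Icc 0 C)
    (m : ℕ) (hm : 0 < m) (t : ℝ) (ht : 0 < t) (ε : ℝ) (hε : ε ∈ Set.Ioo (0 : ℝ) 1) :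
    (1 - ε : ℝ) ≤
      ((Measure.pi fun _ : Fin m => ν) {S : Fin m → Z |
        ∀ θ : Θ, ∫ z, ℓ θ z ∂ν ≤
          (1 / m : ℝ) * ∑ i, ℓ θ (S i)
          + (-Real.log (p θ) - Real.log ε) / (t * m)
          + t * C ^ 2 / 8}).toReal := by
  have hsum : HasSum p 1 := by
    have hs : Summable p := by
      by_contra h
      simp [tsum_eq_zero_of_not_summable h] at hp_sum
    exact hp_sum ▸ hs.hasSum
  refine one_sub_le_measureReal_forall _ (fun θ => (hp_pos θ).le) hsum hε.1.le fun θ => ?_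
  have hm' : (0 : ℝ) < m := Nat.cast_pos.mpr hm
  set a : ℝ := (-Real.log (p θ) - Real.log ε) / t + m * (t * C ^ 2 / 8) with ha
  refine (measureReal_mono fun S hS => ?_).trans
    ((measureReal_pi_integral_sub_sum_ge_le ν (hmeas θ) (hbound θ) m ht.le a).trans_eq ?_)
  · have h := mul_le_mul_of_nonneg_left (not_le.mp hS).le hm'.le
    simp only [Set.mem_ofPred_eq, Finset.sum_sub_distrib, Finset.sum_const, Finset.card_univ,
      Fintype.card_fin, nsmul_eq_mul]
    have heq : (m : ℝ) * ((1 / m : ℝ) * ∑ i, ℓ θ (S i)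
        + (-Real.log (p θ) - Real.log ε) / (t * m) + t * C ^ 2 / 8)
        = ∑ i, ℓ θ (S i) + a := by
      rw [ha]
      field_simp
      ring
    linarith
  · have hexp : -t * a + m * (t ^ 2 * C ^ 2 / 8) = Real.log ε + Real.log (p θ) := by
      rw [ha]
      field_simp
      ring
    rw [hexp, Real.exp_add, Real.exp_log hε.1, Real.exp_log (hp_pos θ)]
end

section
/- Let Θ be a measurable space with prior probability measure π, let (Z, ν) be a probability space, and let ℓ : Θ × Z → ℝ be jointly measurable with 0 ≤ ℓ(θ,z) ≤ 1 for all θ, z. For a sample S = (z_1,…,z_m) ∈ Z^m let R̂_S(θ) = (1/m) Σ_{i=1}^m ℓ(θ, z_i) and R(θ) = ∫ ℓ(θ, z) dν(z). Then for every m ≥ 8 and every ε ∈ (0,1), with probability at least 1 − ε over S drawn from the m-fold product measure ν^{⊗m}: for every probability measure ρ on Θ with finite Kullback–Leibler divergence KL(ρ‖π), ∫ R dρ ≤ ∫ R̂_S dρ + sqrt( (KL(ρ‖π) + log(2·sqrt(m)) − log ε) / (2·m) ). -/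
open MeasureTheory

/-- The generalization gap `R(θ) - R̂_S(θ)` of the parameter `θ` on the sample `S`. -/
noncomputable def generalizationGap {Θ Z : Type*} [MeasurableSpace Z] (ν : Measure Z)
    (ℓ : Θ × Z → ℝ) {m : ℕ} (θ : Θ) (S : Fin m → Z) : ℝ :=
  ∫ z, ℓ (θ, z) ∂ν - (1 / m : ℝ) * ∑ i, ℓ (θ, S i)

/-- Donsker–Varadhan variational inequality. -/
lemma integral_le_integral_llr_add_log {Θ : Type*} [MeasurableSpace Θ] {ρ π : Measure Θ}
    [IsProbabilityMeasure ρ] [IsProbabilityMeasure π] (hρπ : ρ ≪ π)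
    (hllr : Integrable (llr ρ π) ρ) {f : Θ → ℝ} (hfρ : Integrable f ρ)
    (hfπ : Integrable (fun θ => Real.exp (f θ)) π) :
    ∫ θ, f θ ∂ρ ≤ ∫ θ, llr ρ π θ ∂ρ + Real.log (∫ θ, Real.exp (f θ) ∂π) := by
  have := isProbabilityMeasure_tilted hfπ
  have h := InformationTheory.integral_llr_add_sub_measure_univ_nonneg
    (hρπ.trans (absolutelyContinuous_tilted hfπ))
    (integrable_llr_tilted_right hρπ hfρ hllr hfπ)
  rw [integral_llr_tilted_right hρπ hfρ hfπ hllr] at h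
  simp only [probReal_univ] at h
  linarith

lemma empirical_mean_mem_Icc {Θ Z : Type*} {ℓ : Θ × Z → ℝ} {m : ℕ}
    (hbound : ∀ θ z, ℓ (θ, z) ∈ Set.Icc (0 : ℝ) 1) (θ : Θ) (S : Fin m → Z) :
    (1 / m : ℝ) * ∑ i, ℓ (θ, S i) ∈ Set.Icc (0 : ℝ) 1 := by
  have h0 : 0 ≤ ∑ i, ℓ (θ, S i) := Finset.sum_nonneg fun i _ => (hbound θ (S i)).1
  have h1 : ∑ i, ℓ (θ, S i) ≤ m := by
    simpa using Finset.sum_le_sum fun i (_ : i ∈ Finset.univ) => (hbound θ (S i)).2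
  refine ⟨by positivity, ?_⟩
  rw [one_div, inv_mul_eq_div]
  exact div_le_one_of_le₀ h1 (Nat.cast_nonneg m)

section Loss

variable {Θ Z : Type*} [MeasurableSpace Θ] [MeasurableSpace Z]
  {ν : Measure Z} [IsProbabilityMeasure ν] {ℓ : Θ × Z → ℝ} {m : ℕ}

lemma measurable_integral_loss (hmeas : Measurable ℓ) :
    Measurable fun θ => ∫ z, ℓ (θ, z) ∂ν :=
  (StronglyMeasurable.integral_prod_right' hmeas.stronglyMeasurable).measurable

lemma measurable_generalizationGap (hmeas : Measurable ℓ) :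
    Measurable fun p : Θ × (Fin m → Z) => generalizationGap ν ℓ p.1 p.2 := by
  unfold generalizationGap
  refine ((measurable_integral_loss hmeas).comp measurable_fst).sub (Measurable.const_mul ?_ _)
  refine Finset.measurable_sum _ fun i _ => hmeas.comp ?_
  fun_prop

lemma integral_loss_mem_Icc (hmeas : Measurable ℓ)
    (hbound : ∀ θ z, ℓ (θ, z) ∈ Set.Icc (0 : ℝ) 1) (θ : Θ) :
    ∫ z, ℓ (θ, z) ∂ν ∈ Set.Icc (0 : ℝ) 1 := by
  refine ⟨integral_nonneg fun z => (hbound θ z).1, ?_⟩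
  have hint : Integrable (fun z => ℓ (θ, z)) ν :=
    Integrable.of_mem_Icc 0 1 (hmeas.comp measurable_prodMk_left).aemeasurable
      (.of_forall (hbound θ))
  simpa using integral_mono hint (integrable_const (1 : ℝ)) fun z => (hbound θ z).2

lemma generalizationGap_mem_Icc (hmeas : Measurable ℓ)
    (hbound : ∀ θ z, ℓ (θ, z) ∈ Set.Icc (0 : ℝ) 1) (θ : Θ) (S : Fin m → Z) :
    generalizationGap ν ℓ θ S ∈ Set.Icc (-1 : ℝ) 1 := by
  have h1 := integral_loss_mem_Icc (ν := ν) hmeas hbound θ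
  have h2 := empirical_mean_mem_Icc hbound θ S
  unfold generalizationGap
  constructor <;> linarith [h1.1, h1.2, h2.1, h2.2]

/-- Hoeffding's lemma for a single loss value. -/
lemma integral_exp_mul_risk_sub_loss_le (hmeas : Measurable ℓ)
    (hbound : ∀ θ z, ℓ (θ, z) ∈ Set.Icc (0 : ℝ) 1) (θ : Θ) (t : ℝ) :
    ∫ z, Real.exp (t * (∫ w, ℓ (θ, w) ∂ν - ℓ (θ, z))) ∂ν ≤ Real.exp (t ^ 2 / 8) := by
  have h := (ProbabilityTheory.hasSubgaussianMGF_of_mem_Icc (μ := ν)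
    (hmeas.comp (measurable_prodMk_left (x := θ))).aemeasurable
    (.of_forall (hbound θ))).mgf_le (-t)
  simp only [ProbabilityTheory.mgf, Function.comp_apply] at h
  convert h using 2
  · congr! 2
    ring
  · norm_num
    ring

lemma integral_exp_generalizationGap_le (hmeas : Measurable ℓ)
    (hbound : ∀ θ z, ℓ (θ, z) ∈ Set.Icc (0 : ℝ) 1) (hm : 0 < m) (θ : Θ) (t : ℝ) :
    ∫ S : Fin m → Z, Real.exp (t * generalizationGap ν ℓ θ S) ∂(Measure.pi fun _ => ν)
      ≤ Real.exp (t ^ 2 / (8 * m)) := by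
  have hm' : (m : ℝ) ≠ 0 := by positivity
  have hprod (S : Fin m → Z) : Real.exp (t * generalizationGap ν ℓ θ S) =
      ∏ i, Real.exp (t / m * (∫ w, ℓ (θ, w) ∂ν - ℓ (θ, S i))) := by
    rw [← Real.exp_sum, ← Finset.mul_sum, Finset.sum_sub_distrib, generalizationGap]
    simp only [Finset.sum_const, Finset.card_univ, Fintype.card_fin, nsmul_eq_mul]
    congr 1
    field_simp
  simp_rw [hprod]
  rw [integral_fintype_prod_eq_pow
    (fun z => Real.exp (t / m * (∫ w, ℓ (θ, w) ∂ν - ℓ (θ, z)))), Fintype.card_fin]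
  calc _ ≤ Real.exp ((t / m) ^ 2 / 8) ^ m :=
        pow_le_pow_left₀ (integral_nonneg fun _ => (Real.exp_pos _).le)
          (integral_exp_mul_risk_sub_loss_le hmeas hbound θ _) m
    _ = _ := by
        rw [← Real.exp_nat_mul]
        congr 1
        field_simp

lemma exp_mul_generalizationGap_le (hmeas : Measurable ℓ)
    (hbound : ∀ θ z, ℓ (θ, z) ∈ Set.Icc (0 : ℝ) 1) (t : ℝ) (θ : Θ) (S : Fin m → Z) :
    Real.exp (t * generalizationGap ν ℓ θ S) ≤ Real.exp |t| := by
  have h := abs_le.2 (generalizationGap_mem_Icc (ν := ν) hmeas hbound θ S)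
  refine Real.exp_le_exp.2 ((le_abs_self _).trans ?_)
  rw [abs_mul]
  exact mul_le_of_le_one_right (abs_nonneg t) h

lemma integrable_exp_generalizationGap_prod (π : Measure Θ) [IsProbabilityMeasure π]
    (hmeas : Measurable ℓ) (hbound : ∀ θ z, ℓ (θ, z) ∈ Set.Icc (0 : ℝ) 1) (t : ℝ) :
    Integrable (fun p : Θ × (Fin m → Z) => Real.exp (t * generalizationGap ν ℓ p.1 p.2))
      (π.prod (Measure.pi fun _ => ν)) :=
  Integrable.of_bound
    ((measurable_generalizationGap hmeas).const_mul t).exp.aestronglyMeasurable (Real.exp |t|)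
    (.of_forall fun p => by
      simpa using exp_mul_generalizationGap_le hmeas hbound t p.1 p.2)

lemma integrable_exp_generalizationGap (π : Measure Θ) [IsProbabilityMeasure π]
    (hmeas : Measurable ℓ) (hbound : ∀ θ z, ℓ (θ, z) ∈ Set.Icc (0 : ℝ) 1) (t : ℝ)
    (S : Fin m → Z) :
    Integrable (fun θ => Real.exp (t * generalizationGap ν ℓ θ S)) π :=
  Integrable.of_bound
    (((measurable_generalizationGap hmeas).comp
      measurable_prodMk_right).const_mul t).exp.aestronglyMeasurable (Real.exp |t|)
    (.of_forall fun θ => by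
      simpa using exp_mul_generalizationGap_le hmeas hbound t θ S)

lemma integral_integral_exp_generalizationGap_le (π : Measure Θ) [IsProbabilityMeasure π]
    (hmeas : Measurable ℓ) (hbound : ∀ θ z, ℓ (θ, z) ∈ Set.Icc (0 : ℝ) 1) (hm : 0 < m) (t : ℝ) :
    ∫ S : Fin m → Z, ∫ θ, Real.exp (t * generalizationGap ν ℓ θ S) ∂π ∂(Measure.pi fun _ => ν)
      ≤ Real.exp (t ^ 2 / (8 * m)) := by
  have hint := integrable_exp_generalizationGap_prod (m := m) (ν := ν) π hmeas hbound t
  rw [← integral_integral_swap hint]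
  calc _ ≤ ∫ _ : Θ, Real.exp (t ^ 2 / (8 * m)) ∂π :=
        integral_mono hint.integral_prod_left (integrable_const _) fun θ =>
          integral_exp_generalizationGap_le hmeas hbound hm θ t
    _ = _ := by simp

lemma integral_generalizationGap (hmeas : Measurable ℓ)
    (hbound : ∀ θ z, ℓ (θ, z) ∈ Set.Icc (0 : ℝ) 1) (ρ : Measure Θ) [IsProbabilityMeasure ρ]
    (S : Fin m → Z) :
    ∫ θ, generalizationGap ν ℓ θ S ∂ρ =
      ∫ θ, (∫ z, ℓ (θ, z) ∂ν) ∂ρ - ∫ θ, ((1 / m : ℝ) * ∑ i, ℓ (θ, S i)) ∂ρ := by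
  refine integral_sub ?_ ?_
  · exact Integrable.of_mem_Icc 0 1 (measurable_integral_loss hmeas).aemeasurable
      (.of_forall (integral_loss_mem_Icc hmeas hbound))
  · refine Integrable.of_mem_Icc 0 1 (Measurable.aemeasurable ?_)
      (.of_forall fun θ => empirical_mean_mem_Icc hbound θ S)
    exact (Finset.measurable_sum _ fun i _ => hmeas.comp measurable_prodMk_right).const_mul _

/-- Simultaneous exponential moment bound over finitely many temperatures `t j`, by Markov's
inequality and Donsker–Varadhan. -/
lemma measureReal_forall_posterior_ge (π : Measure Θ) [IsProbabilityMeasure π]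
    (hmeas : Measurable ℓ) (hbound : ∀ θ z, ℓ (θ, z) ∈ Set.Icc (0 : ℝ) 1) (hm : 0 < m)
    {N : ℕ} (hN : 0 < N) (t : Fin N → ℝ) {ε : ℝ} (hε : 0 < ε) :
    1 - ε ≤ (Measure.pi fun _ : Fin m => ν).real {S | ∀ ρ : Measure Θ,
      IsProbabilityMeasure ρ → ρ ≪ π → Integrable (llr ρ π) ρ → ∀ j,
        t j * ∫ θ, generalizationGap ν ℓ θ S ∂ρ - t j ^ 2 / (8 * m) ≤
          ∫ θ, llr ρ π θ ∂ρ + Real.log N - Real.log ε} := by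
  set P : Measure (Fin m → Z) := Measure.pi fun _ => ν
  let G (j : Fin N) (S : Fin m → Z) : ℝ :=
    Real.exp (-(t j ^ 2 / (8 * m))) * ∫ θ, Real.exp (t j * generalizationGap ν ℓ θ S) ∂π
  have hG0 (j S) : 0 ≤ G j S :=
    mul_nonneg (Real.exp_pos _).le (integral_nonneg fun _ => (Real.exp_pos _).le)
  have hGint (j) : Integrable (G j) P :=
    (integrable_exp_generalizationGap_prod π hmeas hbound (t j)).integral_prod_right.const_mul _
  have hG1 (j) : ∫ S, G j S ∂P ≤ 1 := by
    rw [integral_const_mul, Real.exp_neg, inv_mul_le_one₀ (Real.exp_pos _)]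
    exact integral_integral_exp_generalizationGap_le π hmeas hbound hm (t j)
  have hN' : (0 : ℝ) < N := by exact_mod_cast hN
  have hmarkov := mul_meas_ge_le_integral_of_nonneg (μ := P) (f := fun S => ∑ j, G j S)
    (.of_forall fun S => Finset.sum_nonneg fun j _ => hG0 j S)
    (integrable_finsetSum _ fun j _ => hGint j) (N / ε)
  rw [integral_finsetSum _ fun j _ => hGint j] at hmarkov
  have hsum : ∑ j, ∫ S, G j S ∂P ≤ N := by
    simpa using Finset.sum_le_sum fun j (_ : j ∈ Finset.univ) => hG1 j
  have hbad : P.real {S | N / ε ≤ ∑ j, G j S} ≤ ε := by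
    have h := hmarkov.trans hsum
    rw [div_mul_eq_mul_div, div_le_iff₀ hε] at h
    exact le_of_mul_le_mul_left h hN'
  have hcompl : 1 ≤ P.real {S | N / ε ≤ ∑ j, G j S} + P.real {S | N / ε ≤ ∑ j, G j S}ᶜ := by
    rw [← probReal_univ (μ := P), ← Set.union_compl_self {S | N / ε ≤ ∑ j, G j S}]
    exact measureReal_union_le _ _
  refine (by linarith : 1 - ε ≤ P.real {S | N / ε ≤ ∑ j, G j S}ᶜ).trans
    (measureReal_mono fun S hS ρ _ hρπ hllr j => ?_)
  have hGj : G j S ≤ N / ε :=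
    (Finset.single_le_sum (fun i _ => hG0 i S) (Finset.mem_univ j)).trans
      (not_le.1 (Set.mem_ofPred.not.1 hS)).le
  have hexp := integrable_exp_generalizationGap (ν := ν) π hmeas hbound (t j) S
  have hgap : Integrable (fun θ => t j * generalizationGap ν ℓ θ S) ρ :=
    (Integrable.of_mem_Icc (-1) 1
      ((measurable_generalizationGap hmeas).comp measurable_prodMk_right).aemeasurable
      (.of_forall fun θ => generalizationGap_mem_Icc hmeas hbound θ S)).const_mul _
  have hDV := integral_le_integral_llr_add_log hρπ hllr hgap hexp
  rw [integral_const_mul] at hDV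
  have hpos := integral_exp_pos hexp
  have hlog := Real.log_le_log (mul_pos (Real.exp_pos _) hpos) hGj
  rw [Real.log_mul (Real.exp_pos _).ne' hpos.ne', Real.log_exp,
    Real.log_div hN'.ne' hε.ne'] at hlog
  linarith

end Loss

lemma mul_exp_inv_two_mul_sq_le {x : ℝ} (h1 : 1 ≤ x) (h2 : x ≤ 3 / 2) :
    x * Real.exp (1 / (2 * x ^ 2)) ≤ 2 := by
  have hx : 0 < x := by linarith
  have hy1 : |1 / (2 * x ^ 2)| ≤ 1 := by
    rw [abs_of_nonneg (by positivity), div_le_one (by positivity)]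
    nlinarith
  have h := (abs_le.1 (Real.abs_exp_sub_one_sub_id_le hy1)).2
  calc x * Real.exp (1 / (2 * x ^ 2))
      ≤ x * (1 + 1 / (2 * x ^ 2) + (1 / (2 * x ^ 2)) ^ 2) := by
        gcongr
        linarith
    _ = (4 * x ^ 4 + 2 * x ^ 2 + 1) / (4 * x ^ 3) := by
        field_simp
        ring
    _ ≤ 2 := by
        rw [div_le_iff₀ (by positivity)]
        nlinarith [mul_nonneg (sub_nonneg.2 h1) (sub_nonneg.2 h2), sq_nonneg (x - 1),
          mul_nonneg (mul_nonneg (sub_nonneg.2 h1) (sub_nonneg.2 h2)) (sq_nonneg x),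
          mul_nonneg (mul_nonneg (sub_nonneg.2 h1) (sub_nonneg.2 h2)) hx.le]

lemma log_ceil_sqrt_add_le {m : ℕ} (hm : 8 ≤ m) :
    Real.log ⌈Real.sqrt m⌉₊ + m / (2 * (⌈Real.sqrt m⌉₊ : ℝ) ^ 2) ≤
      Real.log (2 * Real.sqrt m) := by
  have hm8 : (8 : ℝ) ≤ m := by exact_mod_cast hm
  set s := Real.sqrt m
  have hs2 : s ^ 2 = m := Real.sq_sqrt (by positivity)
  have hs : 2 ≤ s := Real.le_sqrt_of_sq_le (by linarith)
  have hN1 := Nat.le_ceil s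
  have hN2 := Nat.ceil_lt_add_one (show 0 ≤ s by linarith)
  set N : ℝ := (⌈s⌉₊ : ℝ)
  have hspos : 0 < s := by linarith
  have hNpos : 0 < N := by linarith
  have h := mul_exp_inv_two_mul_sq_le (x := N / s) ((one_le_div hspos).2 hN1)
    ((div_le_iff₀ hspos).2 (by linarith))
  have he : 1 / (2 * (N / s) ^ 2) = m / (2 * N ^ 2) := by
    rw [← hs2]
    field_simp
  rw [he, div_mul_eq_mul_div, div_le_iff₀ hspos] at h
  rw [← Real.log_exp (m / (2 * N ^ 2)), ← Real.log_mul hNpos.ne' (Real.exp_pos _).ne']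
  exact Real.log_le_log (by positivity) h

/-- The midpoints of `N` equal cells of length `2 * δ` form a `δ`-net of `[0, 2 * δ * N]`. -/
lemma exists_fin_abs_sub_midpoint_le {N : ℕ} (hN : 0 < N) {δ y : ℝ} (hδ : 0 < δ) (hy : 0 ≤ y)
    (hyN : y ≤ 2 * δ * N) : ∃ j : Fin N, |δ * (2 * (j : ℕ) + 1) - y| ≤ δ := by
  have h2δ : 0 < 2 * δ := by linarith
  rcases hyN.eq_or_lt with rfl | hlt
  · refine ⟨⟨N - 1, by omega⟩, ?_⟩
    rw [Nat.cast_sub hN, abs_le]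
    constructor <;> push_cast <;> nlinarith
  · have hfl := Nat.floor_le (div_nonneg hy h2δ.le)
    have hfl' := Nat.lt_floor_add_one (y / (2 * δ))
    refine ⟨⟨⌊y / (2 * δ)⌋₊, (Nat.floor_lt (div_nonneg hy h2δ.le)).2 ?_⟩, ?_⟩
    · rw [div_lt_iff₀ h2δ]
      linarith
    · rw [le_div_iff₀ h2δ] at hfl
      rw [div_lt_iff₀ h2δ] at hfl'
      rw [abs_le]
      constructor <;> dsimp only <;> linarith

/-- PAC-Bayes theorem (square-root form, Lemma A.1): with probability at least
`1 − ε` over an i.i.d. sample of size `m ≥ 8`, for every posterior `ρ` with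
finite KL divergence to the prior `π`,
`∫ R dρ ≤ ∫ R̂_S dρ + sqrt((KL(ρ‖π) + log(2√m) − log ε)/(2m))`. -/
theorem pac_bayes_sqrt
    {Θ Z : Type*} [MeasurableSpace Θ] [MeasurableSpace Z]
    (π : Measure Θ) [IsProbabilityMeasure π]
    (ν : Measure Z) [IsProbabilityMeasure ν]
    (ℓ : Θ × Z → ℝ) (hmeas : Measurable ℓ)
    (hbound : ∀ θ z, ℓ (θ, z) ∈ Set.Icc (0 : ℝ) 1)
    (m : ℕ) (hm : 8 ≤ m) (ε : ℝ) (hε : ε ∈ Set.Ioo (0 : ℝ) 1) :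
    (1 - ε : ℝ) ≤
      ((Measure.pi fun _ : Fin m => ν) {S : Fin m → Z |
        ∀ ρ : Measure Θ, IsProbabilityMeasure ρ → ρ ≪ π → Integrable (llr ρ π) ρ →
          ∫ θ, (∫ z, ℓ (θ, z) ∂ν) ∂ρ ≤
            (∫ θ, ((1 / m : ℝ) * ∑ i, ℓ (θ, S i)) ∂ρ)
            + Real.sqrt (((∫ θ, llr ρ π θ ∂ρ) + Real.log (2 * Real.sqrt m)
                - Real.log ε) / (2 * m))}).toReal := by
  have hm0 : 0 < m := by omega
  have hmR : (0 : ℝ) < m := by exact_mod_cast hm0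
  have hN : 0 < ⌈Real.sqrt m⌉₊ := Nat.ceil_pos.2 (Real.sqrt_pos.2 hmR)
  have hlogN := log_ceil_sqrt_add_le hm
  set N := ⌈Real.sqrt m⌉₊
  have hNR : (0 : ℝ) < N := by exact_mod_cast hN
  refine (measureReal_forall_posterior_ge (ν := ν) π hmeas hbound hm0 hN
    (fun j => 2 * m / N * (2 * (j : ℕ) + 1)) hε.1).trans
    (measureReal_mono fun S hS ρ _ hρπ hllr => ?_)
  specialize hS ρ inferInstance hρπ hllr
  have hD := integral_generalizationGap (ν := ν) hmeas hbound ρ S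
  have hD1 : ∫ θ, generalizationGap ν ℓ θ S ∂ρ ≤ 1 := by
    refine (le_abs_self _).trans ?_
    simpa using norm_integral_le_of_norm_le_const (μ := ρ) (C := 1)
      (f := fun θ => generalizationGap ν ℓ θ S)
      (.of_forall fun θ => abs_le.2 (generalizationGap_mem_Icc hmeas hbound θ S))
  set D := ∫ θ, generalizationGap ν ℓ θ S ∂ρ
  rw [← sub_le_iff_le_add', ← hD]
  rcases le_or_gt D 0 with hD0 | hD0
  · exact hD0.trans (Real.sqrt_nonneg _)
  obtain ⟨j, hj⟩ := exists_fin_abs_sub_midpoint_le (y := 4 * m * D) hN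
    (show (0 : ℝ) < 2 * m / N by positivity) (by positivity)
    (by
      rw [show 2 * (2 * m / N) * N = 4 * (m : ℝ) by field_simp; ring]
      exact mul_le_of_le_one_right (by positivity) hD1)
  specialize hS j
  set t : ℝ := 2 * m / N * (2 * (j : ℕ) + 1)
  have hsq : (t - 4 * m * D) ^ 2 / (8 * m) ≤ m / (2 * (N : ℝ) ^ 2) := by
    calc (t - 4 * m * D) ^ 2 / (8 * m) ≤ (2 * m / N) ^ 2 / (8 * m) := by
          gcongr ?_ / _
          exact sq_le_sq' (abs_le.1 hj).1 (abs_le.1 hj).2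
      _ = m / (2 * (N : ℝ) ^ 2) := by
          field_simp
          ring
  have hsplit : t * D - t ^ 2 / (8 * m) = 2 * m * D ^ 2 - (t - 4 * m * D) ^ 2 / (8 * m) := by
    field_simp
    ring
  refine Real.le_sqrt_of_sq_le ?_
  rw [le_div_iff₀ (by positivity)]
  linarith
end

section
/- Let Θ be a countable type, let p : Θ → ℝ be a probability mass function with p(θ) > 0 for all θ, let (Z, ν) be a probability space, and let ℓ : Θ × Z → ℝ be measurable in z for each θ with 0 ≤ ℓ(θ,z) ≤ 1 for all θ, z. For a sample S = (z_1,…,z_m) ∈ Z^m let R̂_S(θ) = (1/m) Σ_{i=1}^m ℓ(θ, z_i) and R(θ) = ∫ ℓ(θ, z) dν(z). Then for every m ≥ 8 and every ε ∈ (0,1), with probability at least 1 − ε over S drawn from the m-fold product measure ν^{⊗m}: for every θ ∈ Θ, R(θ) ≤ R̂_S(θ) + sqrt( (−log p(θ) + log(2·sqrt(m)) − log ε) / (2·m) ). -/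
open MeasureTheory

open ProbabilityTheory in
/-- One-sided **Hoeffding inequality** for the empirical mean of a `[0,1]`-valued function under an
i.i.d. sample. -/
theorem measure_pi_add_le_integral_le {Z : Type*} [MeasurableSpace Z]
    (ν : Measure Z) [IsProbabilityMeasure ν] {f : Z → ℝ} (hf : Measurable f)
    (hbound : ∀ z, f z ∈ Set.Icc (0 : ℝ) 1) {m : ℕ} (hm : 0 < m) {t : ℝ} (ht : 0 ≤ t) :
    (Measure.pi fun _ : Fin m => ν).real
      {S | (1 / m : ℝ) * ∑ i, f (S i) + t ≤ ∫ z, f z ∂ν} ≤ Real.exp (-(2 * m * t ^ 2)) := by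
  have hm' : (0 : ℝ) < m := by exact_mod_cast hm
  set g : Z → ℝ := fun z => -(f z - ∫ z, f z ∂ν) with hg_def
  have hg : Measurable g := (hf.sub_const _).neg
  have hsub : HasSubgaussianMGF g ((‖(1 : ℝ) - 0‖₊ / 2) ^ 2) ν :=
    (hasSubgaussianMGF_of_mem_Icc hf.aemeasurable (.of_forall hbound)).neg
  have hindep : iIndepFun (fun (i : Fin m) (S : Fin m → Z) => g (S i))
      (Measure.pi fun _ : Fin m => ν) := iIndepFun_pi fun _ => hg.aemeasurable
  have hsub_eval (i : Fin m) : HasSubgaussianMGF (fun S : Fin m → Z => g (S i))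
      ((‖(1 : ℝ) - 0‖₊ / 2) ^ 2) (Measure.pi fun _ : Fin m => ν) := by
    refine HasSubgaussianMGF.of_map (X := g) (Y := fun S : Fin m → Z => S i)
      (measurable_pi_apply i).aemeasurable ?_
    rwa [(measurePreserving_eval (fun _ : Fin m => ν) i).map_eq]
  have hoeffding := HasSubgaussianMGF.measure_sum_ge_le_of_iIndepFun hindep
    (s := Finset.univ) (fun i _ => hsub_eval i) (mul_nonneg hm'.le ht)
  have hset : {S : Fin m → Z | (1 / m : ℝ) * ∑ i, f (S i) + t ≤ ∫ z, f z ∂ν} =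
      {S | m * t ≤ ∑ i, g (S i)} := by
    ext S
    have hsum : ∑ i, g (S i) = m * ((∫ z, f z ∂ν) - (1 / m : ℝ) * ∑ i, f (S i)) := by
      simp only [hg_def, Finset.sum_neg_distrib, Finset.sum_sub_distrib, Finset.sum_const,
        Finset.card_univ, Fintype.card_fin, nsmul_eq_mul]
      field_simp
      ring
    simp only [Set.mem_ofPred_eq, hsum, mul_le_mul_iff_right₀ hm', le_sub_iff_add_le']
  rw [hset]
  refine hoeffding.trans_eq ?_
  congr 1
  simp
  field_simp

/-- Pointwise PAC-Bayes bound (square-root form) with a countable prior: with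
probability at least `1 − ε` over an i.i.d. sample of size `m ≥ 8`, every
parameter `θ` satisfies
`R(θ) ≤ R̂_S(θ) + sqrt((−log p(θ) + log(2√m) − log ε)/(2m))`. -/
theorem pac_bayes_pointwise_sqrt
    {Θ Z : Type*} [Countable Θ] [MeasurableSpace Z]
    (p : Θ → ℝ) (hp_pos : ∀ θ, 0 < p θ) (hp_sum : ∑' θ, p θ = 1)
    (ν : Measure Z) [IsProbabilityMeasure ν]
    (ℓ : Θ → Z → ℝ) (hmeas : ∀ θ, Measurable (ℓ θ))
    (hbound : ∀ θ z, ℓ θ z ∈ Set.Icc (0 : ℝ) 1)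
    (m : ℕ) (hm : 8 ≤ m) (ε : ℝ) (hε : ε ∈ Set.Ioo (0 : ℝ) 1) :
    (1 - ε : ℝ) ≤
      ((Measure.pi fun _ : Fin m => ν) {S : Fin m → Z |
        ∀ θ : Θ, ∫ z, ℓ θ z ∂ν ≤
          (1 / m : ℝ) * ∑ i, ℓ θ (S i)
          + Real.sqrt ((-Real.log (p θ) + Real.log (2 * Real.sqrt m)
              - Real.log ε) / (2 * m))}).toReal := by
  obtain ⟨hε0, hε1⟩ := hε
  have hm0 : 0 < m := by omega
  have hm' : (0 : ℝ) < m := by exact_mod_cast hm0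
  have hsummable : Summable p := by
    by_contra h
    simp [tsum_eq_zero_of_not_summable h] at hp_sum
  have hp_le (θ : Θ) : p θ ≤ 1 :=
    hp_sum ▸ hsummable.le_tsum θ fun θ' _ => (hp_pos θ').le
  have hsqrt : 1 ≤ 2 * Real.sqrt m := by
    have : 1 ≤ Real.sqrt m := Real.one_le_sqrt.2 (by exact_mod_cast hm0)
    linarith
  set μ := Measure.pi fun _ : Fin m => ν
  set t : Θ → ℝ := fun θ => Real.sqrt
    ((-Real.log (p θ) + Real.log (2 * Real.sqrt m) - Real.log ε) / (2 * m)) with ht_def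
  set bad : Θ → Set (Fin m → Z) := fun θ =>
    {S | (1 / m : ℝ) * ∑ i, ℓ θ (S i) + t θ < ∫ z, ℓ θ z ∂ν} with hbad_def
  have hbad_meas (θ : Θ) : MeasurableSet (bad θ) :=
    measurableSet_lt (((Finset.measurable_sum _ fun i _ =>
      (hmeas θ).comp (measurable_pi_apply i)).const_mul _).add_const _) measurable_const
  have hbad (θ : Θ) : μ (bad θ) ≤ ENNReal.ofReal (ε * p θ) := by
    rw [← ofReal_measureReal]
    refine ENNReal.ofReal_le_ofReal ?_
    have hlogp := Real.log_nonpos (hp_pos θ).le (hp_le θ)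
    have hlogε := Real.log_nonpos hε0.le hε1.le
    have hlogm := Real.log_nonneg hsqrt
    have ht_sq : 2 * m * t θ ^ 2 =
        -Real.log (p θ) + Real.log (2 * Real.sqrt m) - Real.log ε := by
      rw [ht_def, Real.sq_sqrt (div_nonneg (by linarith) (by positivity))]
      field_simp
    calc μ.real (bad θ)
        ≤ μ.real {S | (1 / m : ℝ) * ∑ i, ℓ θ (S i) + t θ ≤ ∫ z, ℓ θ z ∂ν} :=
          measureReal_mono (Set.ofPred_subset_ofPred.2 fun _ => le_of_lt)
      _ ≤ Real.exp (-(2 * m * t θ ^ 2)) :=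
          measure_pi_add_le_integral_le ν (hmeas θ) (hbound θ) hm0 (Real.sqrt_nonneg _)
      _ ≤ Real.exp (Real.log ε + Real.log (p θ)) := by
          rw [ht_sq]
          exact Real.exp_le_exp.2 (by linarith)
      _ = ε * p θ := by rw [Real.exp_add, Real.exp_log hε0, Real.exp_log (hp_pos θ)]
  have hunion : μ (⋃ θ, bad θ) ≤ ENNReal.ofReal ε := calc
    μ (⋃ θ, bad θ) ≤ ∑' θ, μ (bad θ) := measure_iUnion_le _
    _ ≤ ∑' θ, ENNReal.ofReal (ε * p θ) := ENNReal.tsum_le_tsum hbad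
    _ = ENNReal.ofReal ε := by
      rw [← ENNReal.ofReal_tsum_of_nonneg (fun θ => mul_nonneg hε0.le (hp_pos θ).le)
        (hsummable.mul_left ε), tsum_mul_left, hp_sum, mul_one]
  have hgood : {S : Fin m → Z | ∀ θ : Θ, ∫ z, ℓ θ z ∂ν ≤
      (1 / m : ℝ) * ∑ i, ℓ θ (S i) + t θ} = (⋃ θ, bad θ)ᶜ := by
    ext S
    simp [hbad_def]
  change 1 - ε ≤ μ.real _
  rw [hgood, probReal_compl_eq_one_sub (MeasurableSet.iUnion hbad_meas)]
  exact sub_le_sub_left (ENNReal.toReal_le_of_le_ofReal hε0.le hunion) 1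
end

section
/- Let n ≥ 1, let v : Fin n → ℝ, let T > 0, and define the tempered softmax φ_T(v)_c = exp(v_c / T) / Σ_{c'} exp(v_{c'} / T). Let y, ĉ : Fin n with v_c ≤ v_{ĉ} for all c (i.e., ĉ is a maximizer of v). Then the real-valued indicator satisfies 1[ĉ ≠ y] ≤ 2 · (1 − φ_T(v)_y), where 1[P] denotes the real number 1 if P holds and 0 otherwise. -/
/-- Logit inequality (Lemma A.9): if `chat` is a maximizer of the logit vector `v`,
then the 0-1 indicator of `chat ≠ y` is bounded by twice one minus the tempered
softmax probability of the true label `y`. -/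
theorem indicator_le_two_sub_softmax (n : ℕ) (hn : 1 ≤ n) (v : Fin n → ℝ)
    (T : ℝ) (hT : 0 < T) (y chat : Fin n) (hmax : ∀ c, v c ≤ v chat) :
    (if chat ≠ y then (1 : ℝ) else 0) ≤
      2 * (1 - Real.exp (v y / T) / ∑ c', Real.exp (v c' / T)) := by
  have hpos : 0 < ∑ c', Real.exp (v c' / T) :=
    Finset.sum_pos (fun c _ => Real.exp_pos _) ⟨y, Finset.mem_univ y⟩
  split_ifs with h
  · have hpair : Real.exp (v chat / T) + Real.exp (v y / T) ≤ ∑ c', Real.exp (v c' / T) := by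
      rw [← Finset.sum_pair (f := fun c => Real.exp (v c / T)) h]
      exact Finset.sum_le_sum_of_subset_of_nonneg (Finset.subset_univ _)
        fun c _ _ => (Real.exp_pos _).le
    have hle : Real.exp (v y / T) ≤ Real.exp (v chat / T) :=
      Real.exp_le_exp.mpr (div_le_div_of_nonneg_right (hmax y) hT.le)
    have hhalf : Real.exp (v y / T) / ∑ c', Real.exp (v c' / T) ≤ 1 / 2 := by
      rw [div_le_iff₀ hpos]
      linarith
    linarith
  · have hone : Real.exp (v y / T) / ∑ c', Real.exp (v c' / T) ≤ 1 := by
      rw [div_le_one hpos]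
      exact Finset.single_le_sum (f := fun c => Real.exp (v c / T))
        (fun c _ => (Real.exp_pos _).le) (Finset.mem_univ y)
    linarith
end

section
/- Let n ≥ 1 and T > 0, and define the tempered softmax φ_T(v)_c = exp(v_c / T) / Σ_{c'} exp(v_{c'} / T) for v : Fin n → ℝ. Let (Ω, P) be a probability space, let V : Ω → (Fin n → ℝ) and Y : Ω → Fin n be random variables, and let Ĉ : Ω → Fin n be a measurable selection of a maximizer of V, i.e., for all ω and all c, V(ω)_c ≤ V(ω)_{Ĉ(ω)}. Then P({ω : Ĉ(ω) ≠ Y(ω)}) ≤ 2 − 2 · E[φ_T(V)_Y], where E[φ_T(V)_Y] = ∫ φ_T(V(ω))_{Y(ω)} dP(ω). -/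
open MeasureTheory

/-- If `c` is dominated by a different index `d`, its tempered softmax probability is at most
one half. -/
lemma softmax_le_half {ι : Type*} [Fintype ι] {T : ℝ} (hT : 0 < T) (v : ι → ℝ) {c d : ι}
    (hdc : d ≠ c) (hle : v c ≤ v d) :
    Real.exp (v c / T) / ∑ c', Real.exp (v c' / T) ≤ 1 / 2 := by
  classical
  have hexp : Real.exp (v c / T) ≤ Real.exp (v d / T) := by gcongr
  have hpair : Real.exp (v d / T) + Real.exp (v c / T) ≤ ∑ c', Real.exp (v c' / T) := by
    rw [← Finset.sum_pair (f := fun i => Real.exp (v i / T)) hdc]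
    exact Finset.sum_le_sum_of_subset_of_nonneg (Finset.subset_univ _)
      fun _ _ _ => (Real.exp_pos _).le
  have hpos := Real.exp_pos (v c / T)
  rw [div_le_div_iff₀ (by linarith) two_pos]
  linarith

/-- A tempered softmax probability is at most one. -/
lemma softmax_le_one {ι : Type*} [Fintype ι] (T : ℝ) (v : ι → ℝ) (c : ι) :
    Real.exp (v c / T) / ∑ c', Real.exp (v c' / T) ≤ 1 :=
  div_le_one_of_le₀
    (Finset.single_le_sum (f := fun i => Real.exp (v i / T))
      (fun _ _ => (Real.exp_pos _).le) (Finset.mem_univ c))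
    (Finset.sum_nonneg fun _ _ => (Real.exp_pos _).le)

/-- Expectation form of the logit inequality: the probability that the argmax
classifier induced by the random logit vector `V` misclassifies the random
label `Y` is at most `2 − 2·E[φ_T(V)_Y]`. -/
theorem prob_misclassify_le_two_sub_softmax
    (n : ℕ) (hn : 1 ≤ n) (T : ℝ) (hT : 0 < T)
    {Ω : Type*} [MeasurableSpace Ω] (P : Measure Ω) [IsProbabilityMeasure P]
    (V : Ω → Fin n → ℝ) (Y : Ω → Fin n) (Chat : Ω → Fin n)
    (hV : Measurable V) (hY : Measurable Y) (hChat : Measurable Chat)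
    (hmax : ∀ ω c, V ω c ≤ V ω (Chat ω)) :
    (P {ω | Chat ω ≠ Y ω}).toReal ≤
      2 - 2 * ∫ ω, Real.exp (V ω (Y ω) / T) / ∑ c', Real.exp (V ω c' / T) ∂P := by
  have hS : MeasurableSet {ω | Chat ω ≠ Y ω} := (measurableSet_eq_fun hChat hY).compl
  have hint : Integrable ({ω | Chat ω ≠ Y ω}.indicator fun _ => (1 / 2 : ℝ)) P :=
    (integrable_const _).indicator hS
  have hmono : ∫ ω, Real.exp (V ω (Y ω) / T) / ∑ c', Real.exp (V ω c' / T) ∂P ≤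
      ∫ ω, (1 - {ω | Chat ω ≠ Y ω}.indicator (fun _ => (1 / 2 : ℝ)) ω) ∂P := by
    refine integral_mono_of_nonneg (.of_forall fun ω => ?_) ((integrable_const _).sub hint)
      (.of_forall fun ω => ?_)
    · exact div_nonneg (Real.exp_pos _).le (Finset.sum_nonneg fun _ _ => (Real.exp_pos _).le)
    · by_cases h : Chat ω = Y ω
      · simpa [h] using softmax_le_one T (V ω) (Y ω)
      · have := softmax_le_half hT (V ω) h (hmax ω (Y ω))
        simp only [Set.indicator, Set.mem_ofPred_eq, ne_eq, h, not_false_eq_true, if_true]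
        linarith
  rw [integral_sub (integrable_const _) hint, integral_indicator_const _ hS] at hmono
  simp only [integral_const, smul_eq_mul, measureReal_def, measure_univ, ENNReal.toReal_one] at hmono
  linarith
end

section
/- Let n ≥ 1 and T > 0, and define the tempered softmax φ_T(v)_c = exp(v_c / T) / Σ_{c'} exp(v_{c'} / T) for v : Fin n → ℝ. Let (Ω, P) be a probability space, let V : Ω → (Fin n → ℝ) and Y : Ω → Fin n be random variables, let Ĉ : Ω → Fin n be a measurable selection of a maximizer of V (for all ω and all c, V(ω)_c ≤ V(ω)_{Ĉ(ω)}), and let g : Fin n → (Fin n → ℝ) be any family of fixed logit vectors indexed by label (the global per-class logits). Then P({ω : Ĉ(ω) ≠ Y(ω)}) ≤ (2 − 2 · E[φ_T(g(Y))_Y]) + 2 · |E[φ_T(g(Y))_Y] − E[φ_T(V)_Y]|, where E[φ_T(g(Y))_Y] = ∫ φ_T(g(Y(ω)))_{Y(ω)} dP(ω) and E[φ_T(V)_Y] = ∫ φ_T(V(ω))_{Y(ω)} dP(ω). -/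
open MeasureTheory

/-- A softmax weight is at most `1`. -/
lemma exp_div_sum_exp_le_one {ι : Type*} [Fintype ι] (v : ι → ℝ) (T : ℝ) (i : ι) :
    Real.exp (v i / T) / ∑ j, Real.exp (v j / T) ≤ 1 :=
  div_le_one_of_le₀
    (Finset.single_le_sum (f := fun j => Real.exp (v j / T)) (fun _ _ => (Real.exp_pos _).le)
      (Finset.mem_univ i))
    (Finset.sum_nonneg fun _ _ => (Real.exp_pos _).le)

/-- The softmax weight of an index dominated by a different index is at most `1 / 2`. -/
lemma two_mul_exp_div_sum_exp_le_one {ι : Type*} [Fintype ι] {v : ι → ℝ} {T : ℝ} (hT : 0 < T)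
    {i j : ι} (hij : i ≠ j) (h : v i ≤ v j) :
    2 * (Real.exp (v i / T) / ∑ k, Real.exp (v k / T)) ≤ 1 := by
  classical
  have hexp : Real.exp (v i / T) ≤ Real.exp (v j / T) := by gcongr
  have hsum : Real.exp (v i / T) + Real.exp (v j / T) ≤ ∑ k, Real.exp (v k / T) := by
    rw [← Finset.sum_pair (f := fun k => Real.exp (v k / T)) hij]
    exact Finset.sum_le_sum_of_subset_of_nonneg (Finset.subset_univ _)
      fun _ _ _ => (Real.exp_pos _).le
  rw [← mul_div_assoc]
  exact div_le_one_of_le₀ (by linarith) (Finset.sum_nonneg fun _ _ => (Real.exp_pos _).le)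

/-- The softmax weight of a random index under random logits is integrable. -/
lemma integrable_exp_div_sum_exp {Ω ι : Type*} [MeasurableSpace Ω] [Fintype ι]
    [MeasurableSpace ι] [MeasurableSingletonClass ι] {P : Measure Ω} [IsFiniteMeasure P]
    {V : Ω → ι → ℝ} {Y : Ω → ι} (hV : Measurable V) (hY : Measurable Y) (T : ℝ) :
    Integrable (fun ω => Real.exp (V ω (Y ω) / T) / ∑ c, Real.exp (V ω c / T)) P := by
  have heval : Measurable fun p : (ι → ℝ) × ι => p.1 p.2 :=
    measurable_from_prod_countable_left fun c => measurable_pi_apply c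
  have hVY : Measurable fun ω => V ω (Y ω) := heval.comp (hV.prodMk hY)
  have hVc : ∀ c, Measurable fun ω => V ω c := fun c => (measurable_pi_apply c).comp hV
  have hmeas : Measurable fun ω => Real.exp (V ω (Y ω) / T) / ∑ c, Real.exp (V ω c / T) :=
    (hVY.div_const T).exp.div (Finset.measurable_sum _ fun c _ => ((hVc c).div_const T).exp)
  refine Integrable.of_bound (C := 1) hmeas.aestronglyMeasurable ?_
  refine Filter.Eventually.of_forall fun ω => ?_
  rw [Real.norm_of_nonneg (by positivity)]
  exact exp_div_sum_exp_le_one (V ω) T (Y ω)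

/-- The misclassification probability is at most twice the expected softmax mass off the
true label. -/
lemma measureReal_ne_le_two_sub_integral {Ω ι : Type*} [MeasurableSpace Ω] [Fintype ι]
    [MeasurableSpace ι] [MeasurableSingletonClass ι] {P : Measure Ω} [IsProbabilityMeasure P]
    {V : Ω → ι → ℝ} {Y C : Ω → ι} {T : ℝ} (hT : 0 < T)
    (hV : Measurable V) (hY : Measurable Y) (hC : Measurable C)
    (hmax : ∀ ω c, V ω c ≤ V ω (C ω)) :
    P.real {ω | C ω ≠ Y ω} ≤
      2 - 2 * ∫ ω, Real.exp (V ω (Y ω) / T) / ∑ c, Real.exp (V ω c / T) ∂P := by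
  have hint := integrable_exp_div_sum_exp (P := P) hV hY T
  have hmeas : MeasurableSet {ω | C ω ≠ Y ω} := (measurableSet_eq_fun hC hY).compl
  calc P.real {ω | C ω ≠ Y ω}
      = ∫ ω, {ω | C ω ≠ Y ω}.indicator 1 ω ∂P := (integral_indicator_one hmeas).symm
    _ ≤ ∫ ω, (2 - 2 * (Real.exp (V ω (Y ω) / T) / ∑ c, Real.exp (V ω c / T))) ∂P := by
        refine integral_mono ((integrable_const 1).indicator hmeas)
          ((integrable_const 2).sub (hint.const_mul 2)) fun ω => ?_
        by_cases h : C ω = Y ω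
        · have := exp_div_sum_exp_le_one (V ω) T (Y ω)
          simp only [Set.indicator, Set.mem_ofPred_eq, h, ne_eq, not_true_eq_false, if_false]
          linarith
        · have := two_mul_exp_div_sum_exp_le_one hT (Ne.symm h) (hmax ω (Y ω))
          simp only [Set.indicator, Set.mem_ofPred_eq, h, ne_eq, not_false_eq_true, if_true,
            Pi.one_apply]
          linarith
    _ = _ := by
        rw [integral_sub (integrable_const 2) (hint.const_mul 2), integral_const_mul]
        simp

/-- Eq. (CE_KD_eq2): the misclassification probability of the local model is
bounded by an aggregation-error term coming from the global per-class logits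
`g`, plus a distillation-similarity term. -/
theorem prob_misclassify_le_aggregation_add_similarity
    (n : ℕ) (hn : 1 ≤ n) (T : ℝ) (hT : 0 < T)
    {Ω : Type*} [MeasurableSpace Ω] (P : Measure Ω) [IsProbabilityMeasure P]
    (V : Ω → Fin n → ℝ) (Y : Ω → Fin n) (Chat : Ω → Fin n)
    (hV : Measurable V) (hY : Measurable Y) (hChat : Measurable Chat)
    (hmax : ∀ ω c, V ω c ≤ V ω (Chat ω))
    (g : Fin n → Fin n → ℝ) :
    (P {ω | Chat ω ≠ Y ω}).toReal ≤
      (2 - 2 * ∫ ω, Real.exp (g (Y ω) (Y ω) / T) / ∑ c', Real.exp (g (Y ω) c' / T) ∂P)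
      + 2 * |(∫ ω, Real.exp (g (Y ω) (Y ω) / T) / ∑ c', Real.exp (g (Y ω) c' / T) ∂P)
          - ∫ ω, Real.exp (V ω (Y ω) / T) / ∑ c', Real.exp (V ω c' / T) ∂P| := by
  have hbound := measureReal_ne_le_two_sub_integral (P := P) hT hV hY hChat hmax
  rw [Measure.real] at hbound
  refine hbound.trans ?_
  linarith [le_abs_self
    ((∫ ω, Real.exp (g (Y ω) (Y ω) / T) / ∑ c', Real.exp (g (Y ω) c' / T) ∂P)
      - ∫ ω, Real.exp (V ω (Y ω) / T) / ∑ c', Real.exp (V ω c' / T) ∂P)]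
end
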